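/- Let Σ = (σ₀, σ₁, …, σ_m) be an allowable sequence in S_n with pair sequence ((a₁,b₁), …, (a_m,b_m)). Then the sum over k = 1,…,m of the binomial coefficients C(b_k − a_k + 1, 2) equals C(n,2) = n(n−1)/2. In particular the number m of moves satisfies m ≤ n(n−1)/2. -/

import Mathlib

/-- An *allowable sequence* in `Sₙ` (Definition 2.1 of the paper), encoded 0-based:
positions and labels are elements of `Fin n` (position/label `i` corresponds to
`i + 1` in the paper), the permutations are `σ 0, σ 1, …, σ m : Equiv.Perm (Fin n)`,
and the pair sequence is `(a 0, b 0), …, (a (m-1), b (m-1))`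
(the `k`-th move turns `σ k` into `σ (k+1)` by reversing the increasing segment
of positions `a k, a k + 1, …, b k`). -/
structure AllowableSequence (n m : ℕ) where
  /-- the permutations `σ₀, …, σ_m` -/
  σ : Fin (m + 1) → Equiv.Perm (Fin n)
  /-- left endpoints of the moves -/
  a : Fin m → Fin n
  /-- right endpoints of the moves -/
  b : Fin m → Fin n
  /-- `σ₀` is the identity -/
  sigma_zero : σ 0 = 1
  /-- `σ_m` is the order-reversing permutation -/
  sigma_last : ∀ c : Fin n, σ (Fin.last m) c = c.rev
  /-- the intervals are nontrivial -/
  a_lt_b : ∀ i : Fin m, a i < b i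
  /-- `σᵢ` is increasing on the interval `[aᵢ, bᵢ]` of the `i`-th move -/
  mono : ∀ i : Fin m, ∀ c d : Fin n, a i ≤ c → c < d → d ≤ b i →
    σ i.castSucc c < σ i.castSucc d
  /-- inside the interval, the `i`-th move reverses:
  `σ_{i+1}(c) = σ_i(a_i + b_i - c)` -/
  move_in : ∀ i : Fin m, ∀ c d : Fin n, a i ≤ c → c ≤ b i →
    (d : ℕ) = (a i : ℕ) + (b i : ℕ) - (c : ℕ) → σ i.succ c = σ i.castSucc d
  /-- outside the interval, the `i`-th move changes nothing -/
  move_out : ∀ i : Fin m, ∀ c : Fin n, (c < a i ∨ b i < c) → σ i.succ c = σ i.castSucc c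

open Finset in
/-- The number of strictly increasing pairs in a finite set `s` is `C(|s|, 2)`. -/
theorem Finset.card_filter_lt_product {α : Type*} [LinearOrder α] (s : Finset α) :
    ((s ×ˢ s).filter fun p => p.1 < p.2).card = s.card.choose 2 := by
  have hswap : ((s ×ˢ s).filter fun p => p.2 < p.1).card =
      ((s ×ˢ s).filter fun p => p.1 < p.2).card :=
    Finset.card_nbij' Prod.swap Prod.swap (by intro p; simp; tauto) (by intro p; simp; tauto)
      (by intro p; simp) (by intro p; simp)
  have hunion : s.offDiag =
      ((s ×ˢ s).filter fun p => p.1 < p.2) ∪ ((s ×ˢ s).filter fun p => p.2 < p.1) := by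
    ext p
    simp only [mem_offDiag, mem_union, mem_filter, mem_product, ne_iff_lt_or_gt]
    tauto
  have hdisj : Disjoint ((s ×ˢ s).filter fun p => p.1 < p.2)
      ((s ×ˢ s).filter fun p => p.2 < p.1) :=
    disjoint_filter.2 fun p _ h => h.not_gt
  have hcard := s.offDiag_card
  rw [hunion, card_union_of_disjoint hdisj, hswap] at hcard
  rw [Nat.choose_two_right, Nat.mul_sub_one]
  omega

/-- The pairs of positions `(p, q)` with `q < p` whose labels satisfy `τ p < τ q`. -/
def inversionPairs {n : ℕ} (τ : Equiv.Perm (Fin n)) : Finset (Fin n × Fin n) :=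
  Finset.univ.filter fun p => τ p.1 < τ p.2 ∧ p.2 < p.1

/-- Reversal of the interval `[a, b]` of positions. -/
def intervalRev {n : ℕ} (a b c : Fin n) : Fin n :=
  if h : a ≤ c ∧ c ≤ b then ⟨a + b - c, by have := h.1; have := h.2; omega⟩ else c

theorem intervalRev_val {n : ℕ} (a b c : Fin n) :
    (intervalRev a b c : ℕ) =
      if (a : ℕ) ≤ c ∧ (c : ℕ) ≤ b then (a : ℕ) + b - c else c := by
  unfold intervalRev
  simp only [Fin.le_def]
  split_ifs <;> rfl

theorem intervalRev_intervalRev {n : ℕ} (a b c : Fin n) :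
    intervalRev a b (intervalRev a b c) = c := by
  apply Fin.ext
  simp only [intervalRev_val]
  split_ifs <;> omega

theorem intervalRev_lt_intervalRev_iff {n : ℕ} (a b p q : Fin n) :
    intervalRev a b q < intervalRev a b p ↔
      (a ≤ p ∧ p < q ∧ q ≤ b) ∨ (q < p ∧ ¬(a ≤ q ∧ p ≤ b)) := by
  simp only [Fin.lt_def, Fin.le_def, intervalRev_val]
  split_ifs <;> omega

namespace AllowableSequence

variable {n m : ℕ} (A : AllowableSequence n m)

theorem sigma_succ_apply (i : Fin m) (c : Fin n) :
    A.σ i.succ c = A.σ i.castSucc (intervalRev (A.a i) (A.b i) c) := by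
  by_cases h : A.a i ≤ c ∧ c ≤ A.b i
  · exact A.move_in i c _ h.1 h.2 (by rw [intervalRev_val, if_pos (by simpa using h)])
  · rw [intervalRev, dif_neg h]
    exact A.move_out i c (by rcases not_and_or.1 h with h | h <;> simp_all)

/-- Each move creates exactly `C(b - a + 1, 2)` new inversions. -/
theorem card_inversionPairs_succ (i : Fin m) :
    (inversionPairs (A.σ i.succ)).card = (inversionPairs (A.σ i.castSucc)).card +
      ((A.b i : ℕ) - (A.a i : ℕ) + 1).choose 2 := by
  set a := A.a i with ha
  set b := A.b i with hb
  have hab : a < b := A.a_lt_b i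
  have hnew : (((Finset.Icc a b) ×ˢ (Finset.Icc a b)).filter fun p => p.1 < p.2).card =
      ((b : ℕ) - (a : ℕ) + 1).choose 2 := by
    rw [Finset.card_filter_lt_product, Fin.card_Icc]
    congr 1
    omega
  have hdisj : Disjoint (inversionPairs (A.σ i.castSucc))
      (((Finset.Icc a b) ×ˢ (Finset.Icc a b)).filter fun p => p.1 < p.2) := by
    rw [Finset.disjoint_left]
    intro p hp hp'
    exact (Finset.mem_filter.1 hp).2.2.not_gt (Finset.mem_filter.1 hp').2
  have hmem : ∀ p q : Fin n,
      (A.σ i.castSucc p < A.σ i.castSucc q ∧ intervalRev a b q < intervalRev a b p) ↔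
        (p, q) ∈ inversionPairs (A.σ i.castSucc) ∪
          (((Finset.Icc a b) ×ˢ (Finset.Icc a b)).filter fun p => p.1 < p.2) := by
    intro p q
    simp only [intervalRev_lt_intervalRev_iff, inversionPairs, Finset.mem_union,
      Finset.mem_filter, Finset.mem_univ, true_and, Finset.mem_product, Finset.mem_Icc]
    have hpq := A.mono i p q
    have hqp := A.mono i q p
    rw [← ha, ← hb] at hpq hqp
    constructor
    · rintro ⟨h, ⟨h₁, h₂, h₃⟩ | ⟨h₁, -⟩⟩
      · exact Or.inr ⟨⟨⟨h₁, h₂.le.trans h₃⟩, h₁.trans h₂.le, h₃⟩, h₂⟩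
      · exact Or.inl ⟨h, h₁⟩
    · rintro (⟨h, h₁⟩ | ⟨⟨⟨h₁, -⟩, -, h₃⟩, h₂⟩)
      · exact ⟨h, Or.inr ⟨h₁, fun h₂ => (hqp h₂.1 h₁ h₂.2).not_gt h⟩⟩
      · exact ⟨hpq h₁ h₂ h₃, Or.inl ⟨h₁, h₂, h₃⟩⟩
  rw [← hnew, ← Finset.card_union_of_disjoint hdisj]
  refine Finset.card_nbij' (Prod.map (intervalRev a b) (intervalRev a b))
    (Prod.map (intervalRev a b) (intervalRev a b)) ?_ ?_ ?_ ?_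
  · rintro ⟨p, q⟩ h
    rw [Finset.mem_coe, inversionPairs, Finset.mem_filter] at h
    simp only [A.sigma_succ_apply] at h
    refine (hmem _ _).1 ⟨h.2.1, ?_⟩
    simpa only [intervalRev_intervalRev] using h.2.2
  · rintro ⟨p, q⟩ h
    have h' := (hmem p q).2 h
    simpa [inversionPairs, A.sigma_succ_apply, ← ha, ← hb, intervalRev_intervalRev] using h'
  · rintro ⟨p, q⟩ -
    simp [intervalRev_intervalRev]
  · rintro ⟨p, q⟩ -
    simp [intervalRev_intervalRev]

theorem inversionPairs_sigma_zero : inversionPairs (A.σ 0) = ∅ := by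
  simp only [inversionPairs, A.sigma_zero, Equiv.Perm.one_apply]
  exact Finset.filter_false_of_mem fun p _ h => h.1.not_gt h.2

theorem card_inversionPairs_sigma_last :
    (inversionPairs (A.σ (Fin.last m))).card = n.choose 2 := by
  have h := Finset.card_filter_lt_product (Finset.univ : Finset (Fin n))
  rw [Finset.card_univ, Fintype.card_fin] at h
  rw [← h]
  refine Finset.card_nbij' Prod.swap Prod.swap ?_ ?_ ?_ ?_ <;> rintro ⟨p, q⟩ <;>
    simp [inversionPairs, A.sigma_last]

theorem sum_choose_two :
    ∑ k : Fin m, ((A.b k : ℕ) - (A.a k : ℕ) + 1).choose 2 = n.choose 2 := by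
  have hsucc := Fin.sum_univ_succ fun i => (inversionPairs (A.σ i)).card
  have hcast := Fin.sum_univ_castSucc fun i => (inversionPairs (A.σ i)).card
  simp only [card_inversionPairs_succ, Finset.sum_add_distrib, inversionPairs_sigma_zero,
    Finset.card_empty] at hsucc
  rw [card_inversionPairs_sigma_last] at hcast
  omega

end AllowableSequence

/-- The sizes of the moves of an allowable sequence in `Sₙ` satisfy
`∑ₖ C(bₖ - aₖ + 1, 2) = C(n, 2)`; in particular the number `m` of moves is at most
`n(n-1)/2`. -/
theorem sum_moves_choose_two (n m : ℕ) (A : AllowableSequence n m) :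
    (∑ k : Fin m, Nat.choose ((A.b k : ℕ) - (A.a k : ℕ) + 1) 2) = Nat.choose n 2 ∧
      m ≤ n * (n - 1) / 2 := by
  refine ⟨A.sum_choose_two, ?_⟩
  rw [← Nat.choose_two_right, ← A.sum_choose_two]
  calc m = ∑ _k : Fin m, 1 := by simp
    _ ≤ _ := Finset.sum_le_sum fun k _ => Nat.choose_pos (by have := A.a_lt_b k; omega)
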